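/- arXiv:2306.13641 — 3 statements merged into one kernel-verified Lean document; each statement's English description precedes it below -/
import Mathlib

section
/- Let (X, 𝒜, μ) be a σ-finite measure space and let p, q : X → [0,∞) be probability densities with respect to μ. For every measurable D : X → ℝ with 0 < D(x) < 1 for μ-a.e. x such that the function x ↦ p(x)·log D(x) + q(x)·log(1−D(x)) is μ-integrable, one has ∫ (p log D + q log(1−D)) dμ ≤ ∫ (p log(p/(p+q)) + q log(q/(p+q))) dμ, where the right-hand integrand is taken to be 0 on {p+q = 0}. Moreover, the right-hand integrand is μ-integrable, and the bound is attained by the discriminator D₀ defined by D₀(x) = p(x)/(p(x)+q(x)) on {p+q > 0} and D₀(x) = 1/2 elsewhere: ∫ (p log D₀ + q log(1−D₀)) dμ equals the right-hand side. -/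
open MeasureTheory Real
open scoped Classical

lemma mul_log_le_mul_log_div_add {a s d : ℝ} (ha : 0 ≤ a) (hs : 0 < s) (hd : 0 < d) :
    a * log d ≤ a * log (a / s) + (s * d - a) := by
  rcases ha.eq_or_lt with rfl | ha
  · simpa using (mul_pos hs hd).le
  · have hlog : log d = log (a / s) + log (s * d / a) := by
      rw [← log_mul (by positivity) (by positivity)]
      congr 1
      field_simp
    have hle : a * log (s * d / a) ≤ a * (s * d / a - 1) :=
      mul_le_mul_of_nonneg_left (log_le_sub_one_of_pos (by positivity)) ha.le
    have heq : a * (s * d / a - 1) = s * d - a := by field_simp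
    rw [hlog, mul_add]
    linarith

/-- The pointwise discriminator objective is maximal at `a / (a + b)`. -/
lemma mul_log_add_mul_log_one_sub_le {a b d : ℝ} (ha : 0 ≤ a) (hb : 0 ≤ b)
    (hd0 : 0 < d) (hd1 : d < 1) :
    a * log d + b * log (1 - d) ≤ a * log (a / (a + b)) + b * log (b / (a + b)) := by
  rcases (add_nonneg ha hb).eq_or_lt with h | h
  · obtain rfl : a = 0 := by linarith
    obtain rfl : b = 0 := by linarith
    simp
  · linarith [mul_log_le_mul_log_div_add ha h hd0,
      mul_log_le_mul_log_div_add hb h (sub_pos.2 hd1)]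

lemma mul_log_div_add_nonpos {a b : ℝ} (ha : 0 ≤ a) (hb : 0 ≤ b) :
    a * log (a / (a + b)) + b * log (b / (a + b)) ≤ 0 :=
  add_nonpos
    (mul_nonpos_of_nonneg_of_nonpos ha (log_nonpos (by positivity)
      (div_le_one_of_le₀ (by linarith) (by positivity))))
    (mul_nonpos_of_nonneg_of_nonpos hb (log_nonpos (by positivity)
      (div_le_one_of_le₀ (by linarith) (by positivity))))

/-- Optimal discriminator step: for probability densities `p`, `q` w.r.t. a σ-finite measure
`μ`, and any measurable discriminator `D` with `0 < D < 1` μ-a.e. whose objective is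
integrable, the objective `∫ (p log D + q log(1−D)) dμ` is bounded by the value at the optimal
discriminator `p/(p+q)`; the optimal-value integrand is integrable, and the bound is attained by
`D₀ = p/(p+q)` on `{p+q > 0}` and `1/2` elsewhere. -/
theorem optimal_discriminator_integral
    {X : Type*} [MeasurableSpace X] (μ : Measure X) [SigmaFinite μ]
    (p q : X → ℝ) (hpm : Measurable p) (hqm : Measurable q)
    (hp0 : ∀ x, 0 ≤ p x) (hq0 : ∀ x, 0 ≤ q x)
    (hp1 : ∫ x, p x ∂μ = 1) (hq1 : ∫ x, q x ∂μ = 1)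
    (D : X → ℝ) (hDm : Measurable D)
    (hD01 : ∀ᵐ x ∂μ, 0 < D x ∧ D x < 1)
    (hint : Integrable (fun x => p x * log (D x) + q x * log (1 - D x)) μ) :
    Integrable
        (fun x => p x * log (p x / (p x + q x)) + q x * log (q x / (p x + q x))) μ ∧
      ∫ x, (p x * log (D x) + q x * log (1 - D x)) ∂μ ≤
        ∫ x, (p x * log (p x / (p x + q x)) + q x * log (q x / (p x + q x))) ∂μ ∧
      ∫ x, (p x * log (if 0 < p x + q x then p x / (p x + q x) else 1 / 2) +
            q x * log (1 - (if 0 < p x + q x then p x / (p x + q x) else 1 / 2))) ∂μ =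
        ∫ x, (p x * log (p x / (p x + q x)) + q x * log (q x / (p x + q x))) ∂μ := by
  have hle : ∀ᵐ x ∂μ, p x * log (D x) + q x * log (1 - D x) ≤
      p x * log (p x / (p x + q x)) + q x * log (q x / (p x + q x)) := by
    filter_upwards [hD01] with x hx
    exact mul_log_add_mul_log_one_sub_le (hp0 x) (hq0 x) hx.1 hx.2
  have hopt : Integrable
      (fun x => p x * log (p x / (p x + q x)) + q x * log (q x / (p x + q x))) μ := by
    refine hint.mono (Measurable.aestronglyMeasurable (by fun_prop)) ?_
    filter_upwards [hle] with x hx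
    have hx0 := mul_log_div_add_nonpos (hp0 x) (hq0 x)
    rw [norm_of_nonpos hx0, norm_of_nonpos (hx.trans hx0)]
    exact neg_le_neg hx
  refine ⟨hopt, integral_mono_ae hint hopt hle, integral_congr_ae (.of_forall fun x => ?_)⟩
  dsimp only
  split_ifs with h
  · rw [one_sub_div h.ne', add_sub_cancel_left]
  · have hp : p x = 0 := by linarith [hp0 x, hq0 x]
    have hq : q x = 0 := by linarith [hp0 x, hq0 x]
    simp [hp, hq]
end

section
/- Let (X, 𝒜, μ) be a σ-finite measure space, let p : X → [0,∞) be a probability density with respect to μ, and let D : X → ℝ be measurable with 0 < D(x) < 1 for μ-a.e. x in {p > 0}. If the function x ↦ p(x)·(log D(x) + log(1−D(x))) is μ-integrable and ∫ p·(log D + log(1−D)) dμ = −log 4, then D = 1/2 μ-almost everywhere on the set {x : p(x) > 0}. -/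
open MeasureTheory Real

theorem log_add_log_one_sub_le {d : ℝ} (h0 : 0 < d) (h1 : d < 1) :
    log d + log (1 - d) ≤ -log 4 := by
  have h1' : 0 < 1 - d := sub_pos.2 h1
  rw [← log_mul h0.ne' h1'.ne', ← log_inv]
  exact log_le_log (mul_pos h0 h1') (by nlinarith [sq_nonneg (d - 1 / 2)])

theorem eq_half_of_log_add_log_one_sub_eq {d : ℝ} (h0 : 0 < d) (h1 : d < 1)
    (h : log d + log (1 - d) = -log 4) : d = 1 / 2 := by
  have h1' : 0 < 1 - d := sub_pos.2 h1
  rw [← log_mul h0.ne' h1'.ne', ← log_inv] at h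
  have h4 : d * (1 - d) = 4⁻¹ :=
    log_injOn_pos (mul_pos h0 h1') (by norm_num : (0 : ℝ) < 4⁻¹) h
  have hsq : (d - 1 / 2) ^ 2 = 0 := by linarith
  exact sub_eq_zero.1 (pow_eq_zero_iff two_ne_zero |>.1 hsq)

/-- Equilibrium discriminator: if `p` is a probability density w.r.t. a σ-finite measure `μ`,
`D` is measurable with `0 < D < 1` μ-a.e. on `{p > 0}`, the objective
`∫ p·(log D + log(1−D)) dμ` is integrable and equals `−log 4`, then `D = 1/2` μ-a.e. on
`{p > 0}`. -/
theorem equilibrium_discriminator_half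
    {X : Type*} [MeasurableSpace X] (μ : Measure X) [SigmaFinite μ]
    (p : X → ℝ) (hpm : Measurable p) (hp0 : ∀ x, 0 ≤ p x) (hp1 : ∫ x, p x ∂μ = 1)
    (D : X → ℝ) (hDm : Measurable D)
    (hD01 : ∀ᵐ x ∂μ, 0 < p x → 0 < D x ∧ D x < 1)
    (hint : Integrable (fun x => p x * (log (D x) + log (1 - D x))) μ)
    (hval : ∫ x, p x * (log (D x) + log (1 - D x)) ∂μ = -log 4) :
    ∀ᵐ x ∂μ, 0 < p x → D x = 1 / 2 := by
  have hp : Integrable p μ := by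
    by_contra h
    simp [integral_undef h] at hp1
  have hle : (fun x => p x * (log (D x) + log (1 - D x))) ≤ᵐ[μ] fun x => p x * -log 4 := by
    filter_upwards [hD01] with x hx
    rcases (hp0 x).eq_or_lt with h | h
    · simp [← h]
    · exact mul_le_mul_of_nonneg_left (log_add_log_one_sub_le (hx h).1 (hx h).2) h.le
  have heq := (integral_eq_iff_of_ae_le hint (hp.mul_const _) hle).1
    (by rw [hval, integral_mul_const, hp1, one_mul])
  filter_upwards [hD01, heq] with x hx hxe hpos
  exact eq_half_of_log_add_log_one_sub_eq (hx hpos).1 (hx hpos).2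
    (mul_left_cancel₀ hpos.ne' hxe)
end

section
/- Let φ₁, φ₂ : ℝ → ℝ be twice differentiable on (0,1) with φ₁′ > 0, φ₂′ < 0, φ₁″ ≤ 0 and φ₂″ ≤ 0 on (0,1), and let a ∈ (0,1) satisfy φ₁′(a) + φ₂′(a) = 0. Let (X, 𝒜, μ) be a σ-finite measure space and p : X → [0,∞) a probability density with respect to μ. Then for every measurable D : X → ℝ with 0 < D(x) < 1 for μ-a.e. x such that x ↦ p(x)·(φ₁(D(x)) + φ₂(D(x))) is μ-integrable, ∫ p·(φ₁∘D + φ₂∘D) dμ ≤ φ₁(a) + φ₂(a), and the constant discriminator D ≡ a attains this bound. -/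
open MeasureTheory

/-- A concave function on `S` is maximized at an interior critical point. -/
theorem ConcaveOn.isMaxOn_of_hasDerivAt_zero {S : Set ℝ} {f : ℝ → ℝ} {x : ℝ}
    (hf : ConcaveOn ℝ S f) (hx : x ∈ interior S) (hd : HasDerivAt f 0 x) : IsMaxOn f S x := by
  have hmin : IsMinOn (-f) S x := hf.neg.isMinOn_of_rightDeriv_eq_zero hx <| by
    simpa using hd.neg.hasDerivWithinAt.derivWithin (uniqueDiffWithinAt_Ioi x)
  simpa using hmin.neg

/-- Integral form of the generalized equilibrium discriminator: with `φ₁, φ₂` as in the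
generalization of Lemma 1 and `p` a probability density, any a.e.-(0,1)-valued measurable
discriminator `D` with integrable objective has `∫ p·(φ₁(D)+φ₂(D)) dμ ≤ φ₁(a)+φ₂(a)`, and the
constant discriminator `D ≡ a` attains this bound. -/
theorem generalized_optimal_discriminator_integral
    (φ₁ φ₂ φ₁' φ₂' φ₁'' φ₂'' : ℝ → ℝ)
    (hd1 : ∀ y ∈ Set.Ioo (0 : ℝ) 1, HasDerivAt φ₁ (φ₁' y) y)
    (hd2 : ∀ y ∈ Set.Ioo (0 : ℝ) 1, HasDerivAt φ₂ (φ₂' y) y)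
    (hdd1 : ∀ y ∈ Set.Ioo (0 : ℝ) 1, HasDerivAt φ₁' (φ₁'' y) y)
    (hdd2 : ∀ y ∈ Set.Ioo (0 : ℝ) 1, HasDerivAt φ₂' (φ₂'' y) y)
    (hpos : ∀ y ∈ Set.Ioo (0 : ℝ) 1, 0 < φ₁' y)
    (hneg : ∀ y ∈ Set.Ioo (0 : ℝ) 1, φ₂' y < 0)
    (hconc1 : ∀ y ∈ Set.Ioo (0 : ℝ) 1, φ₁'' y ≤ 0)
    (hconc2 : ∀ y ∈ Set.Ioo (0 : ℝ) 1, φ₂'' y ≤ 0)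
    (a : ℝ) (ha : a ∈ Set.Ioo (0 : ℝ) 1) (hcrit : φ₁' a + φ₂' a = 0)
    {X : Type*} [MeasurableSpace X] (μ : Measure X) [SigmaFinite μ]
    (p : X → ℝ) (hpm : Measurable p) (hp0 : ∀ x, 0 ≤ p x) (hp1 : ∫ x, p x ∂μ = 1) :
    (∀ D : X → ℝ, Measurable D → (∀ᵐ x ∂μ, 0 < D x ∧ D x < 1) →
      Integrable (fun x => p x * (φ₁ (D x) + φ₂ (D x))) μ →
      ∫ x, p x * (φ₁ (D x) + φ₂ (D x)) ∂μ ≤ φ₁ a + φ₂ a) ∧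
    ∫ x, p x * (φ₁ a + φ₂ a) ∂μ = φ₁ a + φ₂ a := by
  have hmax : IsMaxOn (φ₁ + φ₂) (Set.Ioo 0 1) a := by
    refine ConcaveOn.isMaxOn_of_hasDerivAt_zero (ConcaveOn.add ?_ ?_)
      (by rwa [interior_Ioo]) (hcrit ▸ (hd1 a ha).add (hd2 a ha))
    · refine concaveOn_of_hasDerivWithinAt2_nonpos (f' := φ₁') (f'' := φ₁'') (convex_Ioo 0 1)
        (fun y hy ↦ (hd1 y hy).continuousAt.continuousWithinAt) ?_ ?_ ?_ <;> rw [interior_Ioo]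
      exacts [fun y hy ↦ (hd1 y hy).hasDerivWithinAt, fun y hy ↦ (hdd1 y hy).hasDerivWithinAt,
        hconc1]
    · refine concaveOn_of_hasDerivWithinAt2_nonpos (f' := φ₂') (f'' := φ₂'') (convex_Ioo 0 1)
        (fun y hy ↦ (hd2 y hy).continuousAt.continuousWithinAt) ?_ ?_ ?_ <;> rw [interior_Ioo]
      exacts [fun y hy ↦ (hd2 y hy).hasDerivWithinAt, fun y hy ↦ (hdd2 y hy).hasDerivWithinAt,
        hconc2]
  have hconst : ∫ x, p x * (φ₁ a + φ₂ a) ∂μ = φ₁ a + φ₂ a := by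
    rw [integral_mul_const, hp1, one_mul]
  have hpi : Integrable p μ := .of_integral_ne_zero (by simp [hp1])
  refine ⟨fun D _ hD hDi ↦ ?_, hconst⟩
  rw [← hconst]
  refine integral_mono_ae hDi (hpi.mul_const _) ?_
  filter_upwards [hD] with x hx
  exact mul_le_mul_of_nonneg_left (hmax hx) (hp0 x)
end
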